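/- Let 𝔤 be the contact Lie superalgebra of odd type 𝔪 or the special contact Lie superalgebra of odd type 𝔰𝔪(κ) over F, let χ ∈ 𝔤_{0̄}^*, M a simple u_χ(𝔤^0)-module, and let v = Σ_{|s|≤m} X^s ⊗ v(s) ∈ K_χ(M) be an eigenvector of some homogeneous element x ∈ 𝔤^3 with eigenvalue a. Then for all s with |s| = m, every nonzero v(s) is an eigenvector of x with eigenvalue a or −a. -/

import Mathlib

/-!
Abstract framework modelling the contact Lie superalgebra of odd type `𝔪`
(and the special contact Lie superalgebra of odd type `𝔰𝔪(κ)`) over an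
algebraically closed field `F` of characteristic `p > 3`, together with
χ-reduced representations and χ-reduced Kac modules, following the paper
"Non-restricted representations of contact and special contact Lie
superalgebras of odd type".
-/

open scoped BigOperators

universe u v

/-- The condition for a `(2n+1)`-tuple of exponents to lie in `I(n, n+1)`:
`r_i < p` for the first `n` (even) slots and `r_i ∈ {0,1}` for the
remaining `n+1` (odd) slots. -/
def IsIdx (p n : ℕ) (r : Fin (2 * n + 1) → ℕ) : Prop :=
  (∀ i : Fin (2 * n + 1), (i : ℕ) < n → r i < p) ∧
    (∀ i : Fin (2 * n + 1), n ≤ (i : ℕ) → r i ≤ 1)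

/-- `‖r‖ = Σ_{k=1}^{n} r_k + Σ_{k=1}^{n} r_{k'} + 2 r_{2n+1}`. -/
def normIdx (n : ℕ) (r : Fin (2 * n + 1) → ℕ) : ℕ :=
  (∑ i, r i) + r ⟨2 * n, by omega⟩

/-- Abstract model of the contact Lie superalgebra of odd type `𝔪` or of the
special contact Lie superalgebra of odd type `𝔰𝔪(κ)`, over an algebraically
closed field `F` of characteristic `p > 3`: a finite-dimensional restricted
Lie superalgebra `g = even ⊕ odd` with super bracket `br`, with its standard
`ℤ`-grading `gr` supported in degrees `≥ -2`, `p`-mapping `pMap`, the ordered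
basis `M_{x_1}, …, M_{x_{2n}}` of `g_{[-1]}` (the unprimed `M_{x_i}`, `i ≤ n`,
being odd and the primed ones even), the element `M_1` spanning `g_{[-2]}`,
the toral elements `h_j` and the nilpotent parts `𝔫₊, 𝔫₋` of `g_{[0]}`. -/
structure OddContactSetup (F : Type u) [Field F] (g : Type v)
    [AddCommGroup g] [Module F g] where
  p : ℕ
  n : ℕ
  hp : p.Prime
  hp3 : 3 < p
  hchar : CharP F p
  halg : IsAlgClosed F
  hn : 0 < n
  findim : FiniteDimensional F g
  /-- the super bracket -/
  br : g →ₗ[F] g →ₗ[F] g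
  /-- the even part `g₀` -/
  even : Submodule F g
  /-- the odd part `g₁` -/
  odd : Submodule F g
  hcompl : IsCompl even odd
  br_ee : ∀ x ∈ even, ∀ y ∈ even, br x y ∈ even
  br_eo : ∀ x ∈ even, ∀ y ∈ odd, br x y ∈ odd
  br_oe : ∀ x ∈ odd, ∀ y ∈ even, br x y ∈ odd
  br_oo : ∀ x ∈ odd, ∀ y ∈ odd, br x y ∈ even
  /-- the standard `ℤ`-grading `g = ⊕_{i ≥ -2} g_{[i]}` -/
  gr : ℤ → Submodule F g
  gr_bot : ∀ i : ℤ, i < -2 → gr i = ⊥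
  gr_internal : DirectSum.IsInternal gr
  gr_br : ∀ (i j : ℤ), ∀ x ∈ gr i, ∀ y ∈ gr j, br x y ∈ gr (i + j)
  /-- the `p`-mapping (the `p`-th associative power on the even part) -/
  pMap : g → g
  pMap_even : ∀ x ∈ even, pMap x ∈ even
  pMap_gr : ∀ (i : ℤ), ∀ x ∈ gr i, x ∈ even → pMap x ∈ gr ((p : ℤ) * i)
  /-- the basis elements `M_{x_1}, …, M_{x_n}, M_{x_{1'}}, …, M_{x_{n'}}` of
  `g_{[-1]}` (0-based: index `j < n` is `M_{x_{j+1}}`, index `n + j` is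
  `M_{x_{(j+1)'}}`) -/
  Mx : Fin (2 * n) → g
  /-- the element `M_1` spanning `g_{[-2]}` -/
  M1 : g
  Mx_gr : ∀ j, Mx j ∈ gr (-1)
  M1_gr : M1 ∈ gr (-2)
  Mx_odd : ∀ j : Fin (2 * n), (j : ℕ) < n → Mx j ∈ odd
  Mx_even : ∀ j : Fin (2 * n), n ≤ (j : ℕ) → Mx j ∈ even
  M1_odd : M1 ∈ odd
  Mx_basis : Submodule.span F (Set.range Mx) = gr (-1)
  Mx_indep : LinearIndependent F Mx
  M1_span : Submodule.span F {M1} = gr (-2)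
  M1_ne : M1 ≠ 0
  /-- the Cartan elements `h_j = M_{x^{(ε_j+ε_{j'})} - x^{(ε_{j+1}+ε_{(j+1)'})}}`,
  `j = 1, …, n-1` -/
  hgen : Fin (n - 1) → g
  hgen_gr : ∀ j, hgen j ∈ gr 0
  hgen_even : ∀ j, hgen j ∈ even
  /-- `𝔫⁺_{[0]}` -/
  nplus : Submodule F g
  /-- `𝔫⁻_{[0]}` -/
  nminus : Submodule F g
  nplus_le : nplus ≤ gr 0
  nminus_le : nminus ≤ gr 0

namespace OddContactSetup

variable {F : Type u} [Field F] {g : Type v} [AddCommGroup g] [Module F g]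
variable (S : OddContactSetup F g)

/-- The filtration `g^i = Σ_{j ≥ i} g_{[j]}`. -/
def filt (i : ℤ) : Submodule F g := ⨆ j ≥ i, S.gr j

/-- The height `ht(χ) = min { i | χ(g^i) = 0 }` of a `p`-character `χ`. -/
noncomputable def ht (χ : Module.Dual F g) : ℤ :=
  sInf {i : ℤ | ∀ x ∈ S.filt i, χ x = 0}

/-- The index set for the PBW monomials
`X^s = M_{x_{1'}}^{s_{1'}} ⋯ M_{x_{n'}}^{s_{n'}} M_{x_n}^{s_n} ⋯ M_{x_1}^{s_1} M_1^{s_{2n+1}}`: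
`s.1` records the exponents `s_{1'}, …, s_{n'}` (each in `{0, …, p-1}`),
`s.2.1` the exponents `s_1, …, s_n` (each in `{0,1}`) and `s.2.2 = s_{2n+1}`. -/
abbrev SIdx : Type :=
  (Fin S.n → Fin S.p) × (Fin S.n → Fin 2) × Fin 2

/-- `|s| = Σ_{i=1}^n (s_i + s_{i'}) + s_{2n+1}`. -/
def sdeg (s : S.SIdx) : ℕ :=
  (∑ i, (s.1 i : ℕ)) + (∑ i, (s.2.1 i : ℕ)) + (s.2.2 : ℕ)

/-- The coordinate `s_j`, `j = 1, …, 2n` (0-based), of the tuple `s`. -/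
def sCoord (s : S.SIdx) (j : Fin (2 * S.n)) : ℕ :=
  if h : (j : ℕ) < S.n then (s.2.1 ⟨(j : ℕ), h⟩ : ℕ)
  else (s.1 ⟨(j : ℕ) - S.n, by have := j.isLt; omega⟩ : ℕ)

/-- A `u_χ(g)`-module structure on `V`: a representation of the restricted
Lie superalgebra `g` with `p`-character `χ`. -/
structure Rep (χ : Module.Dual F g) (V : Type v) [AddCommGroup V] [Module F V] where
  ρ : g →ₗ[F] Module.End F V
  comm_left : ∀ x y : g, x ∈ S.even → ρ (S.br x y) = ρ x * ρ y - ρ y * ρ x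
  comm_right : ∀ x y : g, y ∈ S.even → ρ (S.br x y) = ρ x * ρ y - ρ y * ρ x
  anti : ∀ x y : g, x ∈ S.odd → y ∈ S.odd → ρ (S.br x y) = ρ x * ρ y + ρ y * ρ x
  pchar : ∀ x ∈ S.even, (ρ x) ^ S.p = ρ (S.pMap x) + (χ x) ^ S.p • (1 : Module.End F V)

/-- A `u_χ(hsub)`-module structure on `W`, for a subalgebra `hsub ≤ g`. -/
structure SubRep (hsub : Submodule F g) (χ : Module.Dual F g) (W : Type v)
    [AddCommGroup W] [Module F W] where
  ρ : hsub →ₗ[F] Module.End F W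
  comm_left : ∀ x y : hsub, (x : g) ∈ S.even →
      ∀ hm : S.br (x : g) (y : g) ∈ hsub,
      ρ ⟨S.br (x : g) (y : g), hm⟩ = ρ x * ρ y - ρ y * ρ x
  comm_right : ∀ x y : hsub, (y : g) ∈ S.even →
      ∀ hm : S.br (x : g) (y : g) ∈ hsub,
      ρ ⟨S.br (x : g) (y : g), hm⟩ = ρ x * ρ y - ρ y * ρ x
  anti : ∀ x y : hsub, (x : g) ∈ S.odd → (y : g) ∈ S.odd →
      ∀ hm : S.br (x : g) (y : g) ∈ hsub,
      ρ ⟨S.br (x : g) (y : g), hm⟩ = ρ x * ρ y + ρ y * ρ x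
  pchar : ∀ x : hsub, (x : g) ∈ S.even → ∀ hm : S.pMap (x : g) ∈ hsub,
      (ρ x) ^ S.p = ρ ⟨S.pMap (x : g), hm⟩ + (χ (x : g)) ^ S.p • (1 : Module.End F W)

variable {S}

/-- A submodule `W ≤ V` of a `u_χ(g)`-module is invariant under a subalgebra
`hsub ≤ g`. -/
def Rep.SubInvariant {χ : Module.Dual F g} {V : Type v} [AddCommGroup V] [Module F V]
    (r : Rep S χ V) (hsub : Submodule F g) (W : Submodule F V) : Prop :=
  ∀ x ∈ hsub, ∀ v ∈ W, r.ρ x v ∈ W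

/-- `W` is a simple `u_χ(hsub)`-submodule of the `u_χ(g)`-module `V`. -/
def Rep.SubSimple {χ : Module.Dual F g} {V : Type v} [AddCommGroup V] [Module F V]
    (r : Rep S χ V) (hsub : Submodule F g) (W : Submodule F V) : Prop :=
  W ≠ ⊥ ∧ r.SubInvariant hsub W ∧
    ∀ W' ≤ W, r.SubInvariant hsub W' → W' = ⊥ ∨ W' = W

/-- Simplicity of a `u_χ(g)`-module. -/
def Rep.IsSimple {χ : Module.Dual F g} {V : Type v} [AddCommGroup V] [Module F V]
    (r : Rep S χ V) : Prop :=
  (⊤ : Submodule F V) ≠ ⊥ ∧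
    ∀ W : Submodule F V, r.SubInvariant ⊤ W → W = ⊥ ∨ W = ⊤

/-- Invariance of a subspace of a `u_χ(hsub)`-module. -/
def SubRep.Invariant {hsub : Submodule F g} {χ : Module.Dual F g} {W : Type v}
    [AddCommGroup W] [Module F W] (m : SubRep S hsub χ W) (W' : Submodule F W) : Prop :=
  ∀ x : hsub, ∀ w ∈ W', m.ρ x w ∈ W'

/-- Simplicity of a `u_χ(hsub)`-module. -/
def SubRep.IsSimple {hsub : Submodule F g} {χ : Module.Dual F g} {W : Type v}
    [AddCommGroup W] [Module F W] (m : SubRep S hsub χ W) : Prop :=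
  (⊤ : Submodule F W) ≠ ⊥ ∧ ∀ W' : Submodule F W, m.Invariant W' → W' = ⊥ ∨ W' = ⊤

/-- The operator
`X^s = M_{x_{1'}}^{s_{1'}} ⋯ M_{x_{n'}}^{s_{n'}} M_{x_n}^{s_n} ⋯ M_{x_1}^{s_1} M_1^{s_{2n+1}}`
acting on a `u_χ(g)`-module. -/
noncomputable def Xop {χ : Module.Dual F g} {V : Type v} [AddCommGroup V] [Module F V]
    (r : Rep S χ V) (s : S.SIdx) : Module.End F V :=
  (List.ofFn fun i : Fin S.n =>
      (r.ρ (S.Mx ⟨S.n + (i : ℕ), by have := i.isLt; omega⟩)) ^ ((s.1 i : ℕ))).prod *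
  (List.ofFn fun i : Fin S.n =>
      (r.ρ (S.Mx ⟨S.n - 1 - (i : ℕ), by have := i.isLt; omega⟩)) ^
        ((s.2.1 ⟨S.n - 1 - (i : ℕ), by have := i.isLt; omega⟩ : Fin 2) : ℕ)).prod *
  (r.ρ S.M1) ^ ((s.2.2 : ℕ))

/-- Isomorphism of `u_χ(g)`-modules. -/
def RepIso {χ : Module.Dual F g} {V V' : Type v} [AddCommGroup V] [Module F V]
    [AddCommGroup V'] [Module F V'] (r : Rep S χ V) (r' : Rep S χ V') : Prop :=
  ∃ e : V ≃ₗ[F] V', ∀ (x : g) (v : V), e (r.ρ x v) = r'.ρ x (e v)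

/-- Isomorphism of `u_χ(hsub)`-modules. -/
def SubRepIso {hsub : Submodule F g} {χ : Module.Dual F g} {W W' : Type v}
    [AddCommGroup W] [Module F W] [AddCommGroup W'] [Module F W']
    (m : SubRep S hsub χ W) (m' : SubRep S hsub χ W') : Prop :=
  ∃ e : W ≃ₗ[F] W', ∀ (x : hsub) (w : W), e (m.ρ x w) = m'.ρ x (e w)

/-- The coadjoint action `(Φ·χ)(x) = χ(Φ⁻¹ x)`. -/
def coad (Φ : g ≃ₗ[F] g) (χ : Module.Dual F g) : Module.Dual F g :=
  χ ∘ₗ Φ.symm.toLinearMap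

variable (S)

/-- The `χ`-reduced Kac module `K_χ(M) = u_χ(g) ⊗_{u_χ(g^0)} M` associated
with a `u_χ(g^0)`-module `M`:  a `u_χ(g)`-module `V` together with a
`g^0`-equivariant map `ι : M → V` (`w ↦ 1 ⊗ w`), such that by the PBW theorem
every element of `V` is uniquely of the form `Σ_s X^s ⊗ v(s)`, and satisfying
the universal property of the induced module. -/
structure KacModule (χ : Module.Dual F g) {W : Type v} [AddCommGroup W] [Module F W]
    (M : SubRep S (S.filt 0) χ W) (V : Type v) [AddCommGroup V] [Module F V] where
  rep : Rep S χ V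
  ι : W →ₗ[F] V
  equivariant : ∀ (x : S.filt 0) (w : W), ι (M.ρ x w) = rep.ρ (x : g) (ι w)
  pbw : Function.Bijective fun vc : S.SIdx → W =>
    ∑ s : S.SIdx, Xop rep s (ι (vc s))
  universal : ∀ (V' : Type v) [AddCommGroup V'] [Module F V'] (r' : Rep S χ V')
      (f : W →ₗ[F] V'),
      (∀ (x : S.filt 0) (w : W), f (M.ρ x w) = r'.ρ (x : g) (f w)) →
      ∃! φ : V →ₗ[F] V',
        (∀ (x : g) (v : V), φ (rep.ρ x v) = r'.ρ x (φ v)) ∧ φ ∘ₗ ι = f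

/-- The linear map `u ↦ (χ([u, M_{x_1}]), …, χ([u, M_{x_{2n}}]))` used to
define `rank(χ)`. -/
noncomputable def chiMap (χ : Module.Dual F g) : g →ₗ[F] (Fin (2 * S.n) → F) :=
  LinearMap.pi fun j => χ ∘ₗ (S.br.flip (S.Mx j))

open Classical in
/-- `rank(χ)`: the rank (for `h = ht(χ)`) of the matrix
`χ((f_1,…,f_k)ᵗ(M_{x_1},…,M_{x_{2n}})) ⊕ χ((g_1,…,g_l)ᵗ(M_1))` for bases
`{f_i}` of `g_{[h]}` and `{g_i}` of `g_{[h+1]}` (stated basis-freely). -/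
noncomputable def rankChi (χ : Module.Dual F g) : ℕ :=
  Module.finrank F (Submodule.map (S.chiMap χ) (S.gr (S.ht χ))) +
    (if ∃ u ∈ S.gr (S.ht χ + 1), χ (S.br u S.M1) ≠ 0 then 1 else 0)

/-- `χ` (with `ht(χ) ≥ 2`) is nonsingular if `rank(χ) = 2n + 1`. -/
def Nonsingular (χ : Module.Dual F g) : Prop :=
  2 ≤ S.ht χ ∧ S.rankChi χ = 2 * S.n + 1

/-- Automorphisms of the Lie superalgebra `g` (they preserve the parity and
the filtration). -/
structure IsAut (Φ : g ≃ₗ[F] g) : Prop where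
  map_br : ∀ x y : g, Φ (S.br x y) = S.br (Φ x) (Φ y)
  map_even : ∀ x ∈ S.even, Φ x ∈ S.even
  map_odd : ∀ x ∈ S.odd, Φ x ∈ S.odd
  map_filt : ∀ i : ℤ, Submodule.map Φ.toLinearMap (S.filt i) = S.filt i

/-- `Aut*(g)`: automorphisms preserving each graded piece. -/
def IsAutStar (Φ : g ≃ₗ[F] g) : Prop :=
  S.IsAut Φ ∧ ∀ i : ℤ, Submodule.map Φ.toLinearMap (S.gr i) = S.gr i


/-- `χ` (with `ht(χ) = h ≥ 5` and `rank(χ) = r + 1 < 2n + 1`) is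
`Δ`-invertible (Definition 2.6 of the paper). -/
def DeltaInvertible (χ : Module.Dual F g) : Prop :=
  ∃ (r : ℕ) (hr : r + 1 < 2 * S.n + 1),
    5 ≤ S.ht χ ∧ S.rankChi χ = r + 1 ∧
    ∃ Φ : g ≃ₗ[F] g, S.IsAutStar Φ ∧
      ∃ σ : Equiv.Perm (Fin (2 * S.n)),
        -- (2): the matrix `(Φ·χ)((f_1,…,f_k)ᵗ(M_{x_{i_1}},…,M_{x_{i_r}}))`
        -- has an invertible `r × r` minor (i.e. has full rank `r`)
        Submodule.map
            (LinearMap.pi fun b : Fin r =>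
              (coad Φ χ) ∘ₗ S.br.flip
                (S.Mx (σ ⟨(b : ℕ), by have := b.isLt; omega⟩)))
            (S.gr (S.ht χ)) = ⊤ ∧
        -- (3): `(Φ·χ)([g_{[h]}, M_{x_j}]) = 0` for `j ∈ J`
        (∀ b : Fin (2 * S.n), r ≤ (b : ℕ) → ∀ u ∈ S.gr (S.ht χ),
          coad Φ χ (S.br u (S.Mx (σ b))) = 0) ∧
        -- (4),(5): a `g_{[0]}`-submodule `Δ ⊆ g_{[h-1]}` killed by `Φ·χ`,
        -- containing homogeneous `e_{r+1}, …, e_{2n}` with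
        -- `(Φ·χ)((e_{r+1},…,e_{2n})ᵗ(M_{x_{i_{r+1}}},…,M_{x_{i_{2n}}}))` invertible
        ∃ D : Submodule F g, D ≤ S.gr (S.ht χ - 1) ∧
          (∀ x ∈ S.gr 0, ∀ d ∈ D, S.br x d ∈ D) ∧
          (∀ d ∈ D, coad Φ χ d = 0) ∧
          ∃ e : Fin (2 * S.n - r) → g,
            (∀ b, e b ∈ D) ∧ (∀ b, e b ∈ S.even ∨ e b ∈ S.odd) ∧
            IsUnit (Matrix.det (Matrix.of fun a b : Fin (2 * S.n - r) =>
              coad Φ χ (S.br (e a)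
                (S.Mx (σ ⟨r + (b : ℕ), by have := b.isLt; omega⟩)))))

/-- `χ` with `ht(χ) = 1` is regular semisimple (Definition 3.2). -/
def RegularSemisimple (χ : Module.Dual F g) : Prop :=
  S.ht χ = 1 ∧
    ∃ Φ : g ≃ₗ[F] g, S.IsAut Φ ∧
      (∀ x ∈ S.nplus, coad Φ χ x = 0) ∧
      (∀ x ∈ S.nminus, coad Φ χ x = 0) ∧
      (∀ j : Fin (S.n - 1), coad Φ χ (S.hgen j) ≠ 0) ∧
      coad Φ χ (∑ j : Fin (S.n - 1), S.hgen j) ≠ 0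

end OddContactSetup

/-- The contact Lie superalgebra of odd type `𝔪` itself: an `OddContactSetup`
together with its standard basis `{M_{x^{(r)}} | r ∈ I(n, n+1)}` of monomial
elements, compatible with the grading and with `Mx`, `M1`. -/
structure ContactSetup (F : Type u) [Field F] (g : Type v)
    [AddCommGroup g] [Module F g] extends OddContactSetup F g where
  /-- the standard basis element `M_{x^{(r)}}` -/
  Mmon : (Fin (2 * n + 1) → ℕ) → g
  Mmon_gr : ∀ r, IsIdx p n r → Mmon r ∈ gr ((normIdx n r : ℤ) - 2)
  Mmon_indep : LinearIndependent F fun r : { r // IsIdx p n r } => Mmon r.1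
  Mmon_span : Submodule.span F (Set.range fun r : { r // IsIdx p n r } => Mmon r.1) = ⊤
  Mmon_gr_span : ∀ i : ℤ,
    gr i = Submodule.span F (Mmon '' { r | IsIdx p n r ∧ (normIdx n r : ℤ) = i + 2 })
  Mmon_Mx : ∀ j : Fin (2 * n),
    Mmon (fun i => if (i : ℕ) = (j : ℕ) then 1 else 0) = Mx j
  Mmon_M1 : Mmon (fun _ => 0) = M1

namespace OddContactSetup

section Helpers

variable {F : Type u} [Field F] {g : Type v} [AddCommGroup g] [Module F g]
variable {S : OddContactSetup F g}

/-- homogeneous elements -/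
def Hom (S : OddContactSetup F g) (x : g) : Prop := x ∈ S.even ∨ x ∈ S.odd

/-- labels of the negative generators -/
abbrev Lab (S : OddContactSetup F g) : Type := Fin S.n ⊕ (Fin S.n ⊕ Unit)

instance labBEq (S : OddContactSetup F g) : BEq S.Lab := instBEqOfDecidableEq

instance labLawful (S : OddContactSetup F g) : LawfulBEq S.Lab :=
  inferInstanceAs (@LawfulBEq S.Lab instBEqOfDecidableEq)

/-- the negative generators -/
def gen (S : OddContactSetup F g) : S.Lab → g
  | Sum.inl i => S.Mx ⟨S.n + (i : ℕ), by have := i.isLt; omega⟩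
  | Sum.inr (Sum.inl i) => S.Mx ⟨(i : ℕ), by have := i.isLt; omega⟩
  | Sum.inr (Sum.inr _) => S.M1

lemma gen_hom (t : S.Lab) : S.Hom (S.gen t) := by
  rcases t with i | i | i
  · exact Or.inl (S.Mx_even _ (by simp))
  · exact Or.inr (S.Mx_odd _ (by simp))
  · exact Or.inr S.M1_odd

lemma gen_gr (t : S.Lab) : S.gen t ∈ S.gr (-1) ∨ S.gen t ∈ S.gr (-2) := by
  rcases t with i | i | i
  · exact Or.inl (S.Mx_gr _)
  · exact Or.inl (S.Mx_gr _)
  · exact Or.inr S.M1_gr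

lemma br_hom {x y : g} (hx : S.Hom x) (hy : S.Hom y) : S.Hom (S.br x y) := by
  rcases hx with hx | hx <;> rcases hy with hy | hy
  · exact Or.inl (S.br_ee _ hx _ hy)
  · exact Or.inr (S.br_eo _ hx _ hy)
  · exact Or.inr (S.br_oe _ hx _ hy)
  · exact Or.inl (S.br_oo _ hx _ hy)

variable {χ : Module.Dual F g} {V : Type v} [AddCommGroup V] [Module F V]

lemma superComm (r : Rep S χ V) {x y : g} (hx : S.Hom x) (hy : S.Hom y) :
    ∃ ε : F, (ε = 1 ∨ ε = -1) ∧
      ∀ v, r.ρ x (r.ρ y v) = ε • r.ρ y (r.ρ x v) + r.ρ (S.br x y) v := by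
  by_cases h1 : x ∈ S.even
  · refine ⟨1, Or.inl rfl, fun v => ?_⟩
    rw [r.comm_left x y h1]; simp
  by_cases h2 : y ∈ S.even
  · refine ⟨1, Or.inl rfl, fun v => ?_⟩
    rw [r.comm_right x y h2]; simp
  refine ⟨-1, Or.inr rfl, fun v => ?_⟩
  rw [r.anti x y (hx.resolve_left h1) (hy.resolve_left h2)]; simp

/-- The operator of a word in the negative generators. -/
noncomputable def wop (r : Rep S χ V) (l : List S.Lab) : Module.End F V :=
  (l.map fun t => r.ρ (S.gen t)).prod

@[simp] lemma wop_nil (r : Rep S χ V) : wop r [] = 1 := rfl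

lemma wop_cons (r : Rep S χ V) (t : S.Lab) (l : List S.Lab) (v : V) :
    wop r (t :: l) v = r.ρ (S.gen t) (wop r l v) := by
  simp [wop]

lemma wop_append (r : Rep S χ V) (l l' : List S.Lab) :
    wop r (l ++ l') = wop r l * wop r l' := by
  simp [wop]

variable {W : Type v} [AddCommGroup W] [Module F W]

/-- span of words of length `< k` applied to `1 ⊗ W` -/
def LT (r : Rep S χ V) (ι : W →ₗ[F] V) (k : ℕ) : Submodule F V :=
  Submodule.span F {v | ∃ (l : List S.Lab) (w : W), l.length < k ∧ v = wop r l (ι w)}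

lemma wop_mem (r : Rep S χ V) (ι : W →ₗ[F] V) {l : List S.Lab} {k : ℕ} (h : l.length < k)
    (w : W) : wop r l (ι w) ∈ LT r ι k :=
  Submodule.subset_span ⟨l, w, h, rfl⟩

lemma LT_mono (r : Rep S χ V) (ι : W →ₗ[F] V) {k k' : ℕ} (h : k ≤ k') :
    LT r ι k ≤ LT r ι k' := by
  refine Submodule.span_mono ?_
  rintro v ⟨l, w, hl, rfl⟩
  exact ⟨l, w, lt_of_lt_of_le hl h, rfl⟩

lemma LT_map (r : Rep S χ V) (ι : W →ₗ[F] V) {k k' : ℕ} (f : Module.End F V)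
    (h : ∀ (l : List S.Lab) (w : W), l.length < k → f (wop r l (ι w)) ∈ LT r ι k')
    {v : V} (hv : v ∈ LT r ι k) : f v ∈ LT r ι k' := by
  have : LT r ι k ≤ (LT r ι k').comap f := by
    refine Submodule.span_le.2 ?_
    rintro v ⟨l, w, hl, rfl⟩
    exact h l w hl
  exact this hv

lemma gen_LT (r : Rep S χ V) (ι : W →ₗ[F] V) (t : S.Lab) {k : ℕ} {v : V}
    (hv : v ∈ LT r ι k) : r.ρ (S.gen t) v ∈ LT r ι (k + 1) := by
  refine LT_map r ι (r.ρ (S.gen t)) (fun l w hl => ?_) hv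
  rw [← wop_cons]
  exact wop_mem r ι (by simpa using hl) w

lemma wop_LT (r : Rep S χ V) (ι : W →ₗ[F] V) (l : List S.Lab) {k : ℕ} {v : V}
    (hv : v ∈ LT r ι k) : wop r l v ∈ LT r ι (k + l.length) := by
  induction l with
  | nil => simpa using hv
  | cons t l ih =>
    rw [wop_cons]
    exact gen_LT r ι t ih

lemma neg_gr_LT (r : Rep S χ V) (ι : W →ₗ[F] V) {z : g} {j : ℤ} (hz : z ∈ S.gr j) (hj : j < 0)
    {k : ℕ} {v : V} (hv : v ∈ LT r ι k) : r.ρ z v ∈ LT r ι (k + 1) := by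
  suffices h : S.gr j ≤ (LT r ι (k + 1)).comap (r.ρ.flip v) from h hz
  have hcase : j < -2 ∨ j = -2 ∨ j = -1 := by omega
  rcases hcase with hj | rfl | rfl
  · rw [S.gr_bot j hj]; exact bot_le
  · rw [← S.M1_span]
    refine Submodule.span_le.2 ?_
    rintro _ rfl
    exact gen_LT r ι (Sum.inr (Sum.inr ())) hv
  · rw [← S.Mx_basis]
    refine Submodule.span_le.2 ?_
    rintro _ ⟨j, rfl⟩
    by_cases h : (j : ℕ) < S.n
    · exact gen_LT r ι (Sum.inr (Sum.inl ⟨j, h⟩)) hv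
    · have := gen_LT r ι (Sum.inl ⟨j - S.n, by omega⟩) hv
      have e : (⟨S.n + ((j : ℕ) - S.n), by omega⟩ : Fin (2 * S.n)) = j := by
        ext; simp; omega
      simp only [gen, e] at this
      exact this

lemma gr_le_filt {j : ℤ} (hj : 0 ≤ j) : S.gr j ≤ S.filt 0 :=
  le_iSup₂_of_le (f := fun j (_ : j ≥ (0 : ℤ)) => S.gr j) j hj le_rfl

lemma br_gen_gr {y : g} {j : ℤ} (hy : y ∈ S.gr j) (t : S.Lab) :
    ∃ i : ℤ, j - 2 ≤ i ∧ S.br y (S.gen t) ∈ S.gr i := by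
  rcases gen_gr t with h | h
  · exact ⟨j + -1, by omega, S.gr_br _ _ _ hy _ h⟩
  · exact ⟨j + -2, by omega, S.gr_br _ _ _ hy _ h⟩

variable {M : SubRep S (S.filt 0) χ W} (K : S.KacModule χ M V)

lemma nonneg_LT_word (l : List S.Lab) : ∀ (y : g) (j : ℤ), S.Hom y → y ∈ S.gr j → 0 ≤ j →
    ∀ w : W, K.rep.ρ y (wop K.rep l (K.ι w)) ∈ LT K.rep K.ι (l.length + 1) := by
  induction l with
  | nil =>
    intro y j _ hy hj w
    have h := K.equivariant ⟨y, gr_le_filt hj hy⟩ w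
    simp only [wop_nil, Module.End.one_apply]
    rw [← h]
    exact wop_mem K.rep K.ι (l := []) (by simp) _
  | cons t l ih =>
    intro y j hh hy hj w
    obtain ⟨ε, -, hε⟩ := superComm K.rep hh (gen_hom t)
    rw [wop_cons, hε]
    refine Submodule.add_mem _ (Submodule.smul_mem _ _ (gen_LT _ _ _ (ih y j hh hy hj w))) ?_
    obtain ⟨i, -, hi⟩ := br_gen_gr hy t
    by_cases h0 : 0 ≤ i
    · exact LT_mono _ _ (by simp) (ih _ i (br_hom hh (gen_hom t)) hi h0 w)
    · exact neg_gr_LT _ _ hi (by omega) (wop_mem _ _ (by simp) w)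

lemma top_word (l : List S.Lab) (y : g) (j : ℤ) (hh : S.Hom y) (hy : y ∈ S.gr j) (hj : 2 ≤ j)
    (hf : y ∈ S.filt 0) :
    ∃ ε : F, (ε = 1 ∨ ε = -1) ∧ ∀ w : W,
      K.rep.ρ y (wop K.rep l (K.ι w)) - ε • wop K.rep l (K.ι (M.ρ ⟨y, hf⟩ w)) ∈
        LT K.rep K.ι l.length := by
  induction l with
  | nil =>
    refine ⟨1, Or.inl rfl, fun w => ?_⟩
    simp [K.equivariant]
  | cons t l ih =>
    obtain ⟨ε, h1, h2⟩ := ih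
    obtain ⟨ε', h1', h2'⟩ := superComm K.rep hh (gen_hom t)
    refine ⟨ε' * ε, ?_, fun w => ?_⟩
    · rcases h1 with rfl | rfl <;> rcases h1' with rfl | rfl <;> simp
    · rw [wop_cons, wop_cons, h2']
      obtain ⟨i, hi', hi⟩ := br_gen_gr hy t
      have hb := nonneg_LT_word K l _ i (br_hom hh (gen_hom t)) hi (by omega) w
      have ha := Submodule.smul_mem _ ε' (gen_LT _ _ t (h2 w))
      have hab := Submodule.add_mem _ ha hb
      rw [List.length_cons]
      convert hab using 1
      simp only [map_sub, map_smul, smul_sub, smul_smul]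
      abel

lemma swap_word (l l' : List S.Lab) (h : l.Perm l') :
    ∃ ε : F, (ε = 1 ∨ ε = -1) ∧ ∀ w : W,
      wop K.rep l (K.ι w) - ε • wop K.rep l' (K.ι w) ∈ LT K.rep K.ι l.length := by
  induction h with
  | nil => exact ⟨1, Or.inl rfl, fun w => by simp⟩
  | cons t _ ih =>
    obtain ⟨ε, h1, h2⟩ := ih
    refine ⟨ε, h1, fun w => ?_⟩
    rw [wop_cons, wop_cons, ← map_smul, ← map_sub]
    exact gen_LT _ _ t (h2 w)
  | swap s t l =>
    obtain ⟨ε, h1, h2⟩ := superComm K.rep (gen_hom t) (gen_hom s)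
    refine ⟨ε, h1, fun w => ?_⟩
    simp only [wop_cons]
    rw [h2, add_sub_cancel_left]
    have hneg : ∃ i : ℤ, i < 0 ∧ S.br (S.gen t) (S.gen s) ∈ S.gr i := by
      rcases gen_gr t with h | h <;> rcases gen_gr s with h' | h' <;>
        exact ⟨_, by norm_num, S.gr_br _ _ _ h _ h'⟩
    obtain ⟨i, hi, hb⟩ := hneg
    exact neg_gr_LT _ _ hb hi (wop_mem _ _ (by simp) w)
  | trans h _ ih ih' =>
    obtain ⟨ε, h1, h2⟩ := ih
    obtain ⟨ε', h1', h2'⟩ := ih'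
    refine ⟨ε * ε', ?_, fun w => ?_⟩
    · rcases h1 with rfl | rfl <;> rcases h1' with rfl | rfl <;> simp
    · have hb := h2' w
      rw [← h.length_eq] at hb
      convert Submodule.add_mem _ (h2 w) (Submodule.smul_mem _ ε hb) using 1
      simp only [smul_sub, smul_smul]
      abel

/-- exponent bounds -/
def bd (S : OddContactSetup F g) : S.Lab → ℕ
  | Sum.inl _ => S.p
  | Sum.inr _ => 2

lemma two_ne (S : OddContactSetup F g) : (2 : F) ≠ 0 := by
  have := S.hchar
  intro h
  have h' : ((2 : ℕ) : F) = 0 := by exact_mod_cast h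
  rw [CharP.cast_eq_zero_iff F S.p] at h'
  have := Nat.le_of_dvd (by norm_num) h'
  have := S.hp3
  omega

lemma odd_sq (r : Rep S χ V) (ι : W →ₗ[F] V) {z : g} {j : ℤ} (hz : z ∈ S.odd)
    (hj : z ∈ S.gr j) (hj0 : j < 0) {k : ℕ} {v : V} (hv : v ∈ LT r ι k) :
    r.ρ z (r.ρ z v) ∈ LT r ι (k + 1) := by
  have h1 := neg_gr_LT r ι (S.gr_br _ _ _ hj _ hj) (by omega) hv
  rw [r.anti z z hz hz] at h1
  have h2 := Submodule.smul_mem _ ((2 : F)⁻¹) h1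
  convert h2 using 1
  simp only [LinearMap.add_apply, Module.End.mul_apply]
  rw [← two_smul F, smul_smul, inv_mul_cancel₀ S.two_ne, one_smul]

lemma pow_LT (r : Rep S χ V) (ι : W →ₗ[F] V) (t : S.Lab) {k : ℕ} {v : V} (hv : v ∈ LT r ι k) :
    ((r.ρ (S.gen t)) ^ (S.bd t)) v ∈ LT r ι (k + 1) := by
  rcases t with i | i | i
  · have he := S.Mx_even ⟨S.n + (i : ℕ), by omega⟩ (by simp)
    simp only [bd, gen]
    rw [r.pchar _ he]
    have h := S.pMap_gr _ _ (S.Mx_gr ⟨S.n + (i : ℕ), by omega⟩) (S.Mx_even _ (by simp))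
    have h3 := S.hp3
    refine Submodule.add_mem _ (neg_gr_LT r ι h (by omega) hv) ?_
    exact Submodule.smul_mem _ _ (LT_mono r ι (by omega) hv)
  · simp only [bd, pow_two]
    exact odd_sq r ι (S.Mx_odd _ (by simp)) (S.Mx_gr _) (by omega) hv
  · simp only [bd, pow_two]
    exact odd_sq r ι S.M1_odd S.M1_gr (by omega) hv

lemma wop_replicate (r : Rep S χ V) (t : S.Lab) (k : ℕ) :
    wop r (List.replicate k t) = (r.ρ (S.gen t)) ^ k := by
  simp [wop]

lemma wop_flatten (r : Rep S χ V) (ls : List (List S.Lab)) :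
    wop r ls.flatten = (ls.map (wop r)).prod := by
  induction ls with
  | nil => rfl
  | cons a l ih => rw [List.flatten_cons, wop_append, ih]; simp

/-- the sorted word with the given multiplicities -/
def sword (c : S.Lab → ℕ) : List S.Lab :=
  (List.ofFn fun i : Fin S.n =>
    List.replicate (c (Sum.inl i)) (Sum.inl i : S.Lab)).flatten ++
  (List.ofFn fun i : Fin S.n =>
    List.replicate (c (Sum.inr (Sum.inl i.rev))) (Sum.inr (Sum.inl i.rev) : S.Lab)).flatten ++
  List.replicate (c (Sum.inr (Sum.inr ()))) (Sum.inr (Sum.inr ()))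

/-- multiplicities of a PBW index -/
def mult (s : S.SIdx) : S.Lab → ℕ
  | Sum.inl i => (s.1 i : ℕ)
  | Sum.inr (Sum.inl i) => (s.2.1 i : ℕ)
  | Sum.inr (Sum.inr _) => (s.2.2 : ℕ)

lemma count_sword (c : S.Lab → ℕ) (t : S.Lab) : (sword c).count t = c t := by
  unfold sword
  simp only [List.count_append, List.count_flatten, List.map_ofFn, List.sum_ofFn,
    List.count_replicate, Function.comp_def]
  rcases t with i | i | i
  · simp
  · simp only [beq_iff_eq, Sum.inr.injEq, Sum.inl.injEq, reduceCtorEq, if_false,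
      Finset.sum_const_zero, zero_add, add_zero]
    rw [Finset.sum_eq_single i.rev]
    · simp
    · intro b _ hb
      rw [if_neg]
      rintro rfl
      simp at hb
    · simp
  · simp

lemma length_sword (s : S.SIdx) : (sword (mult s)).length = S.sdeg s := by
  unfold sword sdeg
  simp only [List.length_append, List.length_flatten, List.map_ofFn, List.sum_ofFn,
    List.length_replicate, Function.comp_def, mult]
  congr 2
  exact Equiv.sum_comp Fin.revPerm (fun i => (s.2.1 i : ℕ))

lemma Xop_eq (r : Rep S χ V) (s : S.SIdx) : Xop r s = wop r (sword (mult s)) := by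
  unfold sword Xop
  simp only [wop_append, wop_flatten, wop_replicate, List.map_ofFn, Function.comp_def, mult]
  have e : ∀ i : Fin S.n, i.rev = ⟨S.n - 1 - (i : ℕ), by omega⟩ := by
    intro i; ext; simp [Fin.rev]; omega
  simp only [e, gen]

/-- span of PBW monomials of degree `< k` -/
def UT (r : Rep S χ V) (ι : W →ₗ[F] V) (k : ℕ) : Submodule F V :=
  Submodule.span F {v | ∃ (s : S.SIdx) (w : W), S.sdeg s < k ∧ v = Xop r s (ι w)}

lemma LT_le_UT (k : ℕ) : LT K.rep K.ι k ≤ UT K.rep K.ι k := by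
  induction k with
  | zero =>
    refine Submodule.span_le.2 ?_
    rintro v ⟨l, w, hl, rfl⟩
    omega
  | succ k ih =>
    have hmono : UT K.rep K.ι k ≤ UT K.rep K.ι (k + 1) := by
      refine Submodule.span_mono ?_
      rintro v ⟨l, w, hl, rfl⟩
      exact ⟨l, w, by omega, rfl⟩
    refine Submodule.span_le.2 ?_
    rintro v ⟨l, w, hl, rfl⟩
    by_cases hlk : l.length < k
    · exact hmono (ih (wop_mem _ _ hlk w))
    have hlen : l.length = k := by omega
    -- reduce to any permutation of the word
    have key : ∀ l' : List S.Lab, l.Perm l' →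
        wop K.rep l' (K.ι w) ∈ UT K.rep K.ι (k + 1) →
        wop K.rep l (K.ι w) ∈ UT K.rep K.ι (k + 1) := by
      intro l' hp hm
      obtain ⟨ε, -, h⟩ := swap_word K l l' hp
      have h' := hmono (ih (hlen ▸ h w))
      have := Submodule.add_mem _ h' (Submodule.smul_mem _ ε hm)
      simpa using this
    by_cases hb : ∃ t, S.bd t ≤ l.count t
    · obtain ⟨t, ht⟩ := hb
      have h₂ : l.Perm (List.replicate (S.bd t) t ++ l.diff (List.replicate (S.bd t) t)) :=
        (List.subperm_append_diff_self_of_count_le (by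
          intro x hx
          obtain rfl := List.eq_of_mem_replicate hx
          simpa using ht)).symm
      have hbt : 2 ≤ S.bd t := by
        have := S.hp3
        rcases t with i | i <;> simp [bd] <;> omega
      have hl2 := h₂.length_eq
      rw [List.length_append, List.length_replicate] at hl2
      refine key _ h₂ ?_
      rw [wop_append, wop_replicate, Module.End.mul_apply]
      refine hmono (ih (LT_mono _ _ ?_ (pow_LT _ _ t (wop_mem _ _ (Nat.lt_succ_self _) w))))
      omega
    · push Not at hb
      let s : S.SIdx := ⟨fun i => ⟨l.count (Sum.inl i), hb (Sum.inl i)⟩,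
        fun i => ⟨l.count (Sum.inr (Sum.inl i)), hb (Sum.inr (Sum.inl i))⟩,
        ⟨l.count (Sum.inr (Sum.inr ())), hb (Sum.inr (Sum.inr ()))⟩⟩
      have hp : l.Perm (sword (mult s)) := by
        rw [List.perm_iff_count]
        intro t
        rw [count_sword]
        rcases t with i | i | i <;> rfl
      refine key _ hp ?_
      rw [← Xop_eq]
      refine Submodule.subset_span ⟨s, w, ?_, rfl⟩
      rw [← length_sword, ← hp.length_eq]
      exact hl

lemma UT_repr (k : ℕ) {v : V} (hv : v ∈ UT K.rep K.ι k) :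
    ∃ c : S.SIdx → W, (∀ s, k ≤ S.sdeg s → c s = 0) ∧
      v = ∑ s : S.SIdx, Xop K.rep s (K.ι (c s)) := by
  classical
  induction hv using Submodule.span_induction with
  | mem v h =>
    obtain ⟨s, w, hs, rfl⟩ := h
    refine ⟨Pi.single s w, fun s' hs' => ?_, ?_⟩
    · rw [Pi.single_eq_of_ne]
      rintro rfl
      omega
    · rw [Finset.sum_eq_single s]
      · simp
      · intro b _ hb
        rw [Pi.single_eq_of_ne hb]; simp
      · simp
  | zero => exact ⟨0, by simp, by simp⟩
  | add a b _ _ ha hb =>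
    obtain ⟨c, h1, rfl⟩ := ha
    obtain ⟨c', h1', rfl⟩ := hb
    refine ⟨c + c', fun s hs => by simp [h1 s hs, h1' s hs], ?_⟩
    simp [Finset.sum_add_distrib]
  | smul a v _ ha =>
    obtain ⟨c, h1, rfl⟩ := ha
    refine ⟨a • c, fun s hs => by simp [h1 s hs], ?_⟩
    simp [Finset.smul_sum]

end Helpers

end OddContactSetup

open OddContactSetup in
/-- Lemma 1.1: if `v = Σ_{|s|≤m} X^s ⊗ v(s) ∈ K_χ(M)` is an eigenvector of a
homogeneous element `x ∈ g^3` with eigenvalue `a`, then for all `s` with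
`|s| = m` the nonzero `v(s)` are eigenvectors of `x` with eigenvalue `a` or `-a`. -/
theorem stmt_0
    {F : Type u} [Field F] {g : Type v} [AddCommGroup g] [Module F g]
    (S : OddContactSetup F g)
    (χ : Module.Dual F g) (hχodd : ∀ x ∈ S.odd, χ x = 0)
    {W : Type v} [AddCommGroup W] [Module F W]
    (M : S.SubRep (S.filt 0) χ W) (hM : M.IsSimple)
    {V : Type v} [AddCommGroup V] [Module F V] (K : S.KacModule χ M V)
    (x : g) (d : ℤ) (hd : 3 ≤ d) (hx : x ∈ S.gr d)
    (hxpar : x ∈ S.even ∨ x ∈ S.odd) (hx0 : x ∈ S.filt 0)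
    (a : F) (v : V) (hv0 : v ≠ 0) (heig : K.rep.ρ x v = a • v)
    (vc : S.SIdx → W) (m : ℕ)
    (hv : v = ∑ s : S.SIdx, Xop K.rep s (K.ι (vc s)))
    (hm : ∀ s : S.SIdx, vc s ≠ 0 → S.sdeg s ≤ m) :
    ∀ s : S.SIdx, S.sdeg s = m → vc s ≠ 0 →
      M.ρ ⟨x, hx0⟩ (vc s) = a • vc s ∨ M.ρ ⟨x, hx0⟩ (vc s) = (-a) • vc s := by
  intro s hs hvs
  have hpar : S.Hom x := hxpar
  choose ε hε1 hε2 using fun s : S.SIdx => top_word K (sword (mult s)) x d hpar hx (by omega) hx0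
  have hmem : K.rep.ρ x v - ∑ s : S.SIdx, ε s • Xop K.rep s (K.ι (M.ρ ⟨x, hx0⟩ (vc s))) ∈
      UT K.rep K.ι m := by
    rw [hv, map_sum, ← Finset.sum_sub_distrib]
    refine Submodule.sum_mem _ fun s _ => ?_
    by_cases h0 : vc s = 0
    · simp [h0]
    · have h := hε2 s (vc s)
      rw [length_sword, ← Xop_eq] at h
      exact LT_le_UT K m (LT_mono _ _ (hm s h0) h)
  obtain ⟨c, hc, hceq⟩ := UT_repr K m hmem
  have hfun : (fun s => a • vc s - ε s • M.ρ ⟨x, hx0⟩ (vc s)) = c := by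
    apply K.pbw.1
    simp only
    rw [← hceq, heig, hv, Finset.smul_sum, ← Finset.sum_sub_distrib]
    simp
  have h := congrFun hfun s
  rw [hc s hs.ge] at h
  have h' := sub_eq_zero.1 h
  rcases hε1 s with e | e
  · left
    rw [h', e, one_smul]
  · right
    rw [neg_smul, h', e, neg_smul, one_smul, neg_neg]
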